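/- arXiv:2008.13036 — 9 statements merged into one kernel-verified Lean document; each statement's English description precedes it below -/
import Mathlib

section
/- For every n×m matrix W with nonnegative entries and total budget c = 1ₙᵀW1ₘ, the algebraic connectivity of the supra-Laplacian satisfies λ₂(L(W)) ≤ (1/n + 1/m)·c. -/
open Matrix

noncomputable def supraLap {n m : ℕ} (L₁ : Matrix (Fin n) (Fin n) ℝ)
    (L₂ : Matrix (Fin m) (Fin m) ℝ) (W : Matrix (Fin n) (Fin m) ℝ) :
    Matrix (Fin n ⊕ Fin m) (Fin n ⊕ Fin m) ℝ :=
  Matrix.fromBlocks (L₁ + Matrix.diagonal (W *ᵥ fun _ => 1)) (-W)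
    (-Wᵀ) (L₂ + Matrix.diagonal (Wᵀ *ᵥ fun _ => 1))

noncomputable def lam2 {K : Type*} [Fintype K] (M : Matrix K K ℝ) : ℝ :=
  sInf {r : ℝ | ∃ v : K → ℝ, v ≠ 0 ∧ (∑ i, v i) = 0 ∧
    r = (v ⬝ᵥ (M *ᵥ v)) / (∑ i, (v i) ^ 2)}

theorem supraLap_quad {n m : ℕ} (L₁ : Matrix (Fin n) (Fin n) ℝ)
    (L₂ : Matrix (Fin m) (Fin m) ℝ) (W : Matrix (Fin n) (Fin m) ℝ)
    (x : Fin n → ℝ) (y : Fin m → ℝ) :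
    (Sum.elim x y) ⬝ᵥ (supraLap L₁ L₂ W *ᵥ (Sum.elim x y)) =
      x ⬝ᵥ (L₁ *ᵥ x) + y ⬝ᵥ (L₂ *ᵥ y) + ∑ i, ∑ j, W i j * (x i - y j) ^ 2 := by
  have e1 : x ⬝ᵥ (diagonal (W *ᵥ fun _ => 1) *ᵥ x) = ∑ i, ∑ j, W i j * x i ^ 2 := by
    rw [dotProduct]
    simp only [mulVec_diagonal]
    simp only [dotProduct, mulVec, mul_one,
      Finset.mul_sum, Finset.sum_mul]
    refine Finset.sum_congr rfl fun i _ => Finset.sum_congr rfl fun j _ => by ring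
  have e2 : y ⬝ᵥ (diagonal (Wᵀ *ᵥ fun _ => 1) *ᵥ y) = ∑ i, ∑ j, W i j * y j ^ 2 := by
    rw [Finset.sum_comm]
    rw [dotProduct]
    simp only [mulVec_diagonal]
    simp only [dotProduct, mulVec, mul_one, transpose_apply,
      Finset.mul_sum, Finset.sum_mul]
    refine Finset.sum_congr rfl fun i _ => Finset.sum_congr rfl fun j _ => by ring
  have e3 : x ⬝ᵥ (W *ᵥ y) = ∑ i, ∑ j, W i j * (x i * y j) := by
    simp only [dotProduct, mulVec, Finset.mul_sum]
    refine Finset.sum_congr rfl fun i _ => Finset.sum_congr rfl fun j _ => by ring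
  have e4 : y ⬝ᵥ (Wᵀ *ᵥ x) = ∑ i, ∑ j, W i j * (x i * y j) := by
    rw [Finset.sum_comm]
    simp only [dotProduct, mulVec, Finset.mul_sum, transpose_apply]
    refine Finset.sum_congr rfl fun i _ => Finset.sum_congr rfl fun j _ => by ring
  have e5 : ∑ i, ∑ j, W i j * (x i - y j) ^ 2 = (∑ i, ∑ j, W i j * x i ^ 2)
      + (∑ i, ∑ j, W i j * y j ^ 2) - 2 * ∑ i, ∑ j, W i j * (x i * y j) := by
    simp only [Finset.mul_sum, ← Finset.sum_add_distrib, ← Finset.sum_sub_distrib]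
    refine Finset.sum_congr rfl fun i _ => Finset.sum_congr rfl fun j _ => by ring
  rw [supraLap, fromBlocks_mulVec, sumElim_dotProduct_sumElim]
  simp only [Sum.elim_comp_inl, Sum.elim_comp_inr, add_mulVec, neg_mulVec, dotProduct_add,
    dotProduct_neg]
  rw [e1, e2, e3, e4, e5]
  ring

theorem stmt_0 {n m : ℕ} (hn : 2 ≤ n) (hm : 2 ≤ m)
    (L₁ : Matrix (Fin n) (Fin n) ℝ) (L₂ : Matrix (Fin m) (Fin m) ℝ)
    (hL₁ : L₁.PosSemidef) (hL₂ : L₂.PosSemidef)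
    (hL₁1 : L₁ *ᵥ (fun _ => 1) = 0) (hL₂1 : L₂ *ᵥ (fun _ => 1) = 0)
    (W : Matrix (Fin n) (Fin m) ℝ) (hW : ∀ i j, 0 ≤ W i j) :
    lam2 (supraLap L₁ L₂ W) ≤ (1 / (n : ℝ) + 1 / (m : ℝ)) * (∑ i, ∑ j, W i j) := by
  have hn0 : (0 : ℝ) < n := by exact_mod_cast (by omega : 0 < n)
  have hm0 : (0 : ℝ) < m := by exact_mod_cast (by omega : 0 < m)
  unfold lam2
  apply csInf_le
  · refine ⟨0, ?_⟩
    rintro r ⟨v, -, -, rfl⟩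
    apply div_nonneg _ (Finset.sum_nonneg fun i _ => sq_nonneg _)
    rw [← Sum.elim_comp_inl_inr v, supraLap_quad]
    have h1 := hL₁.dotProduct_mulVec_nonneg (v ∘ Sum.inl)
    have h2 := hL₂.dotProduct_mulVec_nonneg (v ∘ Sum.inr)
    rw [star_trivial] at h1 h2
    have h3 : 0 ≤ ∑ i, ∑ j, W i j * ((v ∘ Sum.inl) i - (v ∘ Sum.inr) j) ^ 2 :=
      Finset.sum_nonneg fun i _ => Finset.sum_nonneg fun j _ =>
        mul_nonneg (hW i j) (sq_nonneg _)
    linarith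
  · refine ⟨Sum.elim (fun _ => (m : ℝ)) (fun _ => -(n : ℝ)), ?_, ?_, ?_⟩
    · intro h
      have := congrFun h (Sum.inl ⟨0, by omega⟩)
      simp at this
      omega
    · simp [Fintype.sum_sum_type]
      ring
    · rw [supraLap_quad]
      have a1 : L₁ *ᵥ (fun _ => (m : ℝ)) = 0 := by
        have : (fun _ : Fin n => (m : ℝ)) = (m : ℝ) • (fun _ => 1) := by ext; simp
        rw [this, mulVec_smul, hL₁1, smul_zero]
      have a2 : L₂ *ᵥ (fun _ => -(n : ℝ)) = 0 := by
        have : (fun _ : Fin m => -(n : ℝ)) = (-(n : ℝ)) • (fun _ => 1) := by ext; simp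
        rw [this, mulVec_smul, hL₂1, smul_zero]
      rw [a1, a2, dotProduct_zero, dotProduct_zero]
      simp only [← Finset.sum_mul, Fintype.sum_sum_type, Sum.elim_inl, Sum.elim_inr,
        Finset.sum_const, Finset.card_univ, Fintype.card_fin, nsmul_eq_mul]
      have : (0 : ℝ) < n * m ^ 2 + m * (-n) ^ 2 := by positivity
      rw [eq_div_iff this.ne']
      field_simp
      ring
end

section
/- If an n×m matrix W with nonnegative entries and total budget c = 1ₙᵀW1ₘ attains the upper bound, i.e. λ₂(L(W)) = (1/n + 1/m)·c, then W is regular: W1ₘ = (c/n)·1ₙ and Wᵀ1ₙ = (c/m)·1ₘ (every node of layer 1 carries total interlayer weight c/n and every node of layer 2 carries total interlayer weight c/m). -/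
open Matrix

lemma lam2_le {K : Type*} [Fintype K] (M : Matrix K K ℝ)
    (hpos : ∀ v : K → ℝ, 0 ≤ v ⬝ᵥ (M *ᵥ v)) (v : K → ℝ) (hs : (∑ i, v i) = 0) :
    lam2 M * (v ⬝ᵥ v) ≤ v ⬝ᵥ (M *ᵥ v) := by
  have hsq : v ⬝ᵥ v = ∑ i, (v i) ^ 2 := by simp [dotProduct, sq]
  by_cases hv : v = 0
  · simp [hv]
  have hp : 0 < v ⬝ᵥ v := by
    have h0 : 0 ≤ v ⬝ᵥ v := by rw [hsq]; positivity
    exact lt_of_le_of_ne h0 (fun h => hv (dotProduct_self_eq_zero.mp h.symm))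
  rw [← le_div_iff₀ hp]
  refine csInf_le ⟨0, ?_⟩ ⟨v, hv, hs, by rw [hsq]⟩
  rintro r ⟨w, -, -, rfl⟩
  exact div_nonneg (hpos w) (by positivity)

lemma lam2_eig {K : Type*} [Fintype K] (M : Matrix K K ℝ) (hM : Mᵀ = M)
    (hpos : ∀ v : K → ℝ, 0 ≤ v ⬝ᵥ (M *ᵥ v)) (v : K → ℝ) (hs : (∑ i, v i) = 0)
    (hMs : (∑ i, (M *ᵥ v) i) = 0) (h : v ⬝ᵥ (M *ᵥ v) = lam2 M * (v ⬝ᵥ v)) :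
    M *ᵥ v = lam2 M • v := by
  set l := lam2 M with hl
  set g := M *ᵥ v - l • v with hg
  have hgs : (∑ i, g i) = 0 := by
    simp [hg, Finset.sum_sub_distrib, ← Finset.mul_sum, hs, hMs]
  have hsym : v ⬝ᵥ (M *ᵥ g) = g ⬝ᵥ (M *ᵥ v) := by
    rw [dotProduct_mulVec, ← mulVec_transpose, hM, dotProduct_comm]
  have hgg : g ⬝ᵥ g = g ⬝ᵥ (M *ᵥ v) - l * (g ⬝ᵥ v) := by
    conv_lhs => rw [hg]
    conv_lhs => arg 1; rw [← hg]
    rw [dotProduct_sub, dotProduct_smul, smul_eq_mul]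
  have key : ∀ t : ℝ, 0 ≤ (g ⬝ᵥ (M *ᵥ g) - l * (g ⬝ᵥ g)) * (t * t) + (2 * (g ⬝ᵥ g)) * t + 0 := by
    intro t
    have h1 := lam2_le M hpos (v + t • g) (by
      simp [Finset.sum_add_distrib, ← Finset.mul_sum, hs, hgs])
    simp only [mulVec_add, mulVec_smul, dotProduct_add, add_dotProduct, dotProduct_smul,
      smul_dotProduct, smul_eq_mul, hsym, dotProduct_comm v g, ← hl, h] at h1
    generalize g ⬝ᵥ (M *ᵥ g) = a at *
    generalize g ⬝ᵥ (M *ᵥ v) = b at *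
    generalize g ⬝ᵥ g = d at *
    subst hgg
    linarith
  have hd := discrim_le_zero key
  have h0 : g ⬝ᵥ g = 0 := by
    unfold discrim at hd
    nlinarith [sq_nonneg (g ⬝ᵥ g)]
  exact sub_eq_zero.mp (dotProduct_self_eq_zero.mp h0)

lemma supra_symm {n m : ℕ} (L₁ : Matrix (Fin n) (Fin n) ℝ)
    (L₂ : Matrix (Fin m) (Fin m) ℝ) (h1 : L₁.PosSemidef) (h2 : L₂.PosSemidef)
    (W : Matrix (Fin n) (Fin m) ℝ) : (supraLap L₁ L₂ W)ᵀ = supraLap L₁ L₂ W := by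
  have e1 : L₁ᵀ = L₁ := by simpa using h1.isHermitian.eq
  have e2 : L₂ᵀ = L₂ := by simpa using h2.isHermitian.eq
  simp [supraLap, fromBlocks_transpose, e1, e2]

lemma supra_pos {n m : ℕ} (L₁ : Matrix (Fin n) (Fin n) ℝ)
    (L₂ : Matrix (Fin m) (Fin m) ℝ) (h1 : L₁.PosSemidef) (h2 : L₂.PosSemidef)
    (W : Matrix (Fin n) (Fin m) ℝ) (hW : ∀ i j, 0 ≤ W i j) (v : Fin n ⊕ Fin m → ℝ) :
    0 ≤ v ⬝ᵥ (supraLap L₁ L₂ W *ᵥ v) := by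
  obtain ⟨x, y, rfl⟩ : ∃ x y, v = Sum.elim x y := ⟨_, _, (Sum.elim_comp_inl_inr v).symm⟩
  have p1 : 0 ≤ x ⬝ᵥ (L₁ *ᵥ x) := by simpa using h1.dotProduct_mulVec_nonneg x
  have p2 : 0 ≤ y ⬝ᵥ (L₂ *ᵥ y) := by simpa using h2.dotProduct_mulVec_nonneg y
  have p3 : 0 ≤ ∑ i, ∑ j, W i j * (x i - y j) ^ 2 :=
    Finset.sum_nonneg fun i _ => Finset.sum_nonneg fun j _ => mul_nonneg (hW i j) (sq_nonneg _)
  have a1 : x ⬝ᵥ (diagonal (W *ᵥ fun _ => 1) *ᵥ x) = ∑ i, ∑ j, W i j * x i ^ 2 := by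
    simp only [dotProduct, mulVec_diagonal, mulVec, mul_one, Finset.sum_mul, Finset.mul_sum]
    refine Finset.sum_congr rfl fun i _ => ?_
    simp only [diagonal_apply, ite_mul, zero_mul, mul_ite, mul_zero, Finset.sum_ite_eq,
      Finset.mem_univ, if_true, mulVec, dotProduct, mul_one, transpose_apply, Finset.sum_mul,
      Finset.mul_sum]
    exact Finset.sum_congr rfl fun j _ => by ring
  have a2 : y ⬝ᵥ (diagonal (Wᵀ *ᵥ fun _ => 1) *ᵥ y) = ∑ i, ∑ j, W i j * y j ^ 2 := by
    rw [Finset.sum_comm]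
    simp only [dotProduct, mulVec, mul_one, Finset.sum_mul, Finset.mul_sum]
    refine Finset.sum_congr rfl fun i _ => ?_
    simp only [diagonal_apply, ite_mul, zero_mul, mul_ite, mul_zero, Finset.sum_ite_eq,
      Finset.mem_univ, if_true, mulVec, dotProduct, mul_one, transpose_apply, Finset.sum_mul,
      Finset.mul_sum]
    exact Finset.sum_congr rfl fun j _ => by ring
  have a3 : x ⬝ᵥ (W *ᵥ y) = ∑ i, ∑ j, W i j * (x i * y j) := by
    simp only [dotProduct, mulVec, Finset.mul_sum]
    exact Finset.sum_congr rfl fun i _ => Finset.sum_congr rfl fun j _ => by ring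
  have a4 : y ⬝ᵥ (Wᵀ *ᵥ x) = ∑ i, ∑ j, W i j * (x i * y j) := by
    rw [Finset.sum_comm]
    simp only [dotProduct, mulVec, Finset.mul_sum, transpose_apply]
    exact Finset.sum_congr rfl fun i _ => Finset.sum_congr rfl fun j _ => by ring
  have p4 : ∑ i, ∑ j, W i j * (x i - y j) ^ 2 = (∑ i, ∑ j, W i j * x i ^ 2)
      + (∑ i, ∑ j, W i j * y j ^ 2) - 2 * ∑ i, ∑ j, W i j * (x i * y j) := by
    simp only [Finset.mul_sum, ← Finset.sum_add_distrib, ← Finset.sum_sub_distrib]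
    exact Finset.sum_congr rfl fun i _ => Finset.sum_congr rfl fun j _ => by ring
  rw [supraLap, fromBlocks_mulVec, sumElim_dotProduct_sumElim]
  simp only [Sum.elim_comp_inl, Sum.elim_comp_inr, add_mulVec, neg_mulVec, dotProduct_add,
    dotProduct_neg, a1, a2, a3, a4]
  linarith

theorem stmt_2 {n m : ℕ} (hn : 2 ≤ n) (hm : 2 ≤ m)
    (L₁ : Matrix (Fin n) (Fin n) ℝ) (L₂ : Matrix (Fin m) (Fin m) ℝ)
    (hL₁ : L₁.PosSemidef) (hL₂ : L₂.PosSemidef)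
    (hL₁1 : L₁ *ᵥ (fun _ => 1) = 0) (hL₂1 : L₂ *ᵥ (fun _ => 1) = 0)
    (W : Matrix (Fin n) (Fin m) ℝ) (hW : ∀ i j, 0 ≤ W i j)
    (c : ℝ) (hc : c = ∑ i, ∑ j, W i j)
    (hopt : lam2 (supraLap L₁ L₂ W) = (1 / (n : ℝ) + 1 / (m : ℝ)) * c) :
    (W *ᵥ fun _ => 1) = (fun _ => c / n) ∧ (Wᵀ *ᵥ fun _ => 1) = (fun _ => c / m) := by
  have hn0 : (n : ℝ) ≠ 0 := by positivity
  have hm0 : (m : ℝ) ≠ 0 := by positivity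
  set v : Fin n ⊕ Fin m → ℝ := Sum.elim (fun _ => (m : ℝ)) (fun _ => -(n : ℝ)) with hv
  have hMv : supraLap L₁ L₂ W *ᵥ v = Sum.elim (fun i => ((n : ℝ) + m) * ∑ j, W i j)
      (fun j => -((n : ℝ) + m) * ∑ i, W i j) := by
    have c1 : (fun _ => (m : ℝ) : Fin n → ℝ) = (m : ℝ) • (fun _ => 1) := by ext; simp
    have c2 : (fun _ => -(n : ℝ) : Fin m → ℝ) = (-(n : ℝ)) • (fun _ => 1) := by ext; simp
    rw [supraLap, hv, fromBlocks_mulVec]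
    simp only [Sum.elim_comp_inl, Sum.elim_comp_inr, c1, c2, mulVec_smul, add_mulVec, hL₁1, hL₂1]
    congr 1
    · ext i
      simp [mulVec, dotProduct, diagonal_apply]
      ring
    · ext i
      simp [mulVec, dotProduct, diagonal_apply]
      ring
  have hc' : c = ∑ j, ∑ i, W i j := by rw [hc, Finset.sum_comm]
  have hs : ∑ i, v i = 0 := by simp [hv, Fintype.sum_sum_type]; ring
  have hMs : ∑ i, (supraLap L₁ L₂ W *ᵥ v) i = 0 := by
    rw [hMv]
    simp only [Fintype.sum_sum_type, Sum.elim_inl, Sum.elim_inr, ← Finset.mul_sum, ← hc, ← hc']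
    ring
  have hq : v ⬝ᵥ (supraLap L₁ L₂ W *ᵥ v) = lam2 (supraLap L₁ L₂ W) * (v ⬝ᵥ v) := by
    rw [hMv, hopt, hv, sumElim_dotProduct_sumElim, sumElim_dotProduct_sumElim]
    simp only [dotProduct, ← Finset.mul_sum, ← hc, ← hc', Finset.sum_const, Finset.card_univ,
      Fintype.card_fin, nsmul_eq_mul]
    field_simp
    ring
  have he := lam2_eig _ (supra_symm L₁ L₂ hL₁ hL₂ W) (supra_pos L₁ L₂ hL₁ hL₂ W hW) v hs hMs hq
  rw [hMv, hopt] at he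
  have hN : (n : ℝ) + m ≠ 0 := by positivity
  constructor
  · ext i
    have h := congrFun he (Sum.inl i)
    simp only [hv, Sum.elim_inl, Pi.smul_apply, smul_eq_mul] at h
    simp only [mulVec, dotProduct, mul_one]
    apply mul_left_cancel₀ hN
    rw [h]
    field_simp
    ring
  · ext j
    have h := congrFun he (Sum.inr j)
    simp only [hv, Sum.elim_inr, Pi.smul_apply, smul_eq_mul] at h
    simp only [mulVec, dotProduct, mul_one, transpose_apply]
    apply mul_left_cancel₀ (neg_ne_zero.mpr hN)
    rw [h]
    field_simp
    ring
end

section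
/- If an n×m matrix W with nonnegative entries satisfies the regularity conditions W1ₘ = (c/n)·1ₙ and Wᵀ1ₙ = (c/m)·1ₘ for some c ≥ 0, then the vector v ∈ ℝᴺ with first n components equal to m and last m components equal to −n is an eigenvector of the supra-Laplacian: L(W)·v = (1/n + 1/m)·c·v. -/
open Matrix

theorem stmt_3 {n m : ℕ} (hn : 2 ≤ n) (hm : 2 ≤ m)
    (L₁ : Matrix (Fin n) (Fin n) ℝ) (L₂ : Matrix (Fin m) (Fin m) ℝ)
    (hL₁ : L₁.PosSemidef) (hL₂ : L₂.PosSemidef)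
    (hL₁1 : L₁ *ᵥ (fun _ => 1) = 0) (hL₂1 : L₂ *ᵥ (fun _ => 1) = 0)
    (W : Matrix (Fin n) (Fin m) ℝ) (hW : ∀ i j, 0 ≤ W i j)
    (c : ℝ) (hc : 0 ≤ c)
    (hreg1 : (W *ᵥ fun _ => 1) = (fun _ => c / n))
    (hreg2 : (Wᵀ *ᵥ fun _ => 1) = (fun _ => c / m)) :
    supraLap L₁ L₂ W *ᵥ (Sum.elim (fun _ => (m : ℝ)) (fun _ => -(n : ℝ))) =
      ((1 / (n : ℝ) + 1 / (m : ℝ)) * c) •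
        (Sum.elim (fun _ => (m : ℝ)) (fun _ => -(n : ℝ))) := by
  have hn0 : (n : ℝ) ≠ 0 := by positivity
  have hm0 : (m : ℝ) ≠ 0 := by positivity
  have e : ∀ (k : ℕ) (a : ℝ), (fun _ : Fin k => a) = a • (fun _ : Fin k => (1 : ℝ)) := by
    intro k a
    ext i
    simp
  unfold supraLap
  rw [Matrix.fromBlocks_mulVec]
  ext i
  rcases i with i | j
  · simp only [Sum.elim_inl, Sum.elim_comp_inl, Sum.elim_comp_inr, Pi.add_apply, Pi.smul_apply,
      smul_eq_mul, Matrix.add_mulVec, Matrix.neg_mulVec, Pi.neg_apply, Matrix.mulVec_diagonal]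
    rw [e n (m : ℝ), e m (-(n : ℝ)), Matrix.mulVec_smul, Matrix.mulVec_smul, hL₁1, hreg1]
    simp only [Pi.smul_apply, smul_eq_mul, Pi.zero_apply]
    field_simp
    ring
  · simp only [Sum.elim_inr, Sum.elim_comp_inl, Sum.elim_comp_inr, Pi.add_apply, Pi.smul_apply,
      smul_eq_mul, Matrix.add_mulVec, Matrix.neg_mulVec, Pi.neg_apply, Matrix.mulVec_diagonal]
    rw [e n (m : ℝ), e m (-(n : ℝ)), Matrix.mulVec_smul, Matrix.mulVec_smul, hL₂1, hreg2]
    simp only [Pi.smul_apply, smul_eq_mul, Pi.zero_apply]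
    field_simp
    ring
end

section
/- (Projections of optimal embeddings yield eigenvectors.) Let L be a real symmetric N×N matrix with L1 = 0, and let λ, μ ∈ ℝ. Let X be a real symmetric N×N positive semidefinite matrix with trace(X) = 1 and 1ᵀX1 = 0. If the matrix L + μ·11ᵀ − λ·I is positive semidefinite and trace(X·(L + μ·11ᵀ − λ·I)) = 0 (complementary slackness between the primal and dual semidefinite programs), then X1 = 0 and, for every h ∈ ℝᴺ, L·(Xh) = λ·(Xh); in particular every nonzero projection Xh of the embedding Gram matrix X is an eigenvector of L with eigenvalue λ. -/
open Matrix

open scoped MatrixOrder in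
theorem mul_eq_zero_of_trace_psd {N : ℕ} {X M : Matrix (Fin N) (Fin N) ℝ}
    (hX : X.PosSemidef) (hM : M.PosSemidef) (h : (X * M).trace = 0) : M * X = 0 := by
  obtain ⟨B, rfl⟩ := CStarAlgebra.nonneg_iff_eq_star_mul_self.mp hX.nonneg
  obtain ⟨C, rfl⟩ := CStarAlgebra.nonneg_iff_eq_star_mul_self.mp hM.nonneg
  simp only [Matrix.star_eq_conjTranspose] at h ⊢
  have h1 : ((B * Cᴴ)ᴴ * (B * Cᴴ)).trace = 0 := by
    rw [← h, Matrix.conjTranspose_mul, Matrix.conjTranspose_conjTranspose]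
    rw [← Matrix.mul_assoc (Bᴴ * B), Matrix.trace_mul_comm (Bᴴ * B * Cᴴ) C]
    simp only [Matrix.mul_assoc]
  have h2 := Matrix.trace_conjTranspose_mul_self_eq_zero_iff.1 h1
  have h3 : C * Bᴴ = 0 := by
    simpa using congrArg Matrix.conjTranspose h2
  rw [Matrix.mul_assoc, ← Matrix.mul_assoc C, h3]
  simp

theorem stmt_7 {N : ℕ} (hN : 2 ≤ N)
    (L : Matrix (Fin N) (Fin N) ℝ) (hLsymm : L.IsSymm)
    (hL1 : L *ᵥ (fun _ => 1) = 0)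
    (lam μ : ℝ)
    (X : Matrix (Fin N) (Fin N) ℝ) (hX : X.PosSemidef)
    (hXtr : X.trace = 1)
    (hX1 : (fun _ => (1 : ℝ)) ⬝ᵥ (X *ᵥ fun _ => 1) = 0)
    (hpsd : (L + μ • Matrix.of (fun _ _ : Fin N => (1 : ℝ)) - lam • (1 : Matrix (Fin N) (Fin N) ℝ)).PosSemidef)
    (hcs : (X * (L + μ • Matrix.of (fun _ _ : Fin N => (1 : ℝ)) - lam • (1 : Matrix (Fin N) (Fin N) ℝ))).trace = 0) :
    (X *ᵥ fun _ => 1) = 0 ∧ ∀ h : Fin N → ℝ, L *ᵥ (X *ᵥ h) = lam • (X *ᵥ h) := by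
  have hXone : (X *ᵥ fun _ => 1) = 0 := by
    apply (hX.dotProduct_mulVec_zero_iff _).1
    have hs : star (fun _ : Fin N => (1 : ℝ)) = fun _ => 1 := by
      ext i; simp
    rw [hs]; exact hX1
  refine ⟨hXone, fun h => ?_⟩
  have hMX := mul_eq_zero_of_trace_psd hX hpsd hcs
  have hv := congrArg (fun A => A *ᵥ h) hMX
  simp only [← Matrix.mulVec_mulVec, Matrix.zero_mulVec, Matrix.sub_mulVec, Matrix.add_mulVec,
    Matrix.smul_mulVec, Matrix.one_mulVec] at hv
  have hJ : (Matrix.of (fun _ _ : Fin N => (1 : ℝ))) *ᵥ (X *ᵥ h) = 0 := by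
    ext i
    have hT : Xᵀ = X := by simpa using hX.1.eq
    change (fun _ : Fin N => (1 : ℝ)) ⬝ᵥ (X *ᵥ h) = 0
    rw [Matrix.dotProduct_mulVec, ← Matrix.mulVec_transpose, hT, hXone, zero_dotProduct]
  rw [hJ, smul_zero, add_zero] at hv
  exact sub_eq_zero.1 hv
end

section
/- Suppose W is an n×m matrix with nonnegative entries, total budget c = 1ₙᵀW1ₘ, satisfying the regularity conditions W1ₘ = (c/n)·1ₙ and Wᵀ1ₙ = (c/m)·1ₘ, and λ₂(L(W)) = (1/n + 1/m)·c. Let v ∈ ℝᴺ have first n components equal to m and last m components equal to −n, and set X = (1/(nm(n+m)))·vvᵀ. Then X is positive semidefinite, trace(X) = 1, X·1_N = 0, and L(W)·X = λ₂(L(W))·X; that is, the optimal embedding is one-dimensional, with all nodes of layer 1 clumped at the point m·h and all nodes of layer 2 clumped at −n·h along a line h. -/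
open Matrix

theorem stmt_8 {n m : ℕ} (hn : 2 ≤ n) (hm : 2 ≤ m)
    (L₁ : Matrix (Fin n) (Fin n) ℝ) (L₂ : Matrix (Fin m) (Fin m) ℝ)
    (hL₁ : L₁.PosSemidef) (hL₂ : L₂.PosSemidef)
    (hL₁1 : L₁ *ᵥ (fun _ => 1) = 0) (hL₂1 : L₂ *ᵥ (fun _ => 1) = 0)
    (W : Matrix (Fin n) (Fin m) ℝ) (hW : ∀ i j, 0 ≤ W i j)
    (c : ℝ) (hc : c = ∑ i, ∑ j, W i j)
    (hreg1 : (W *ᵥ fun _ => 1) = (fun _ => c / n))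
    (hreg2 : (Wᵀ *ᵥ fun _ => 1) = (fun _ => c / m))
    (hopt : lam2 (supraLap L₁ L₂ W) = (1 / (n : ℝ) + 1 / (m : ℝ)) * c) :
    let v : Fin n ⊕ Fin m → ℝ := Sum.elim (fun _ => (m : ℝ)) (fun _ => -(n : ℝ))
    let X : Matrix (Fin n ⊕ Fin m) (Fin n ⊕ Fin m) ℝ :=
      (1 / ((n : ℝ) * m * (n + m))) • Matrix.of (fun i j => v i * v j)
    X.PosSemidef ∧ X.trace = 1 ∧ (X *ᵥ fun _ => 1) = 0 ∧
      supraLap L₁ L₂ W * X = lam2 (supraLap L₁ L₂ W) • X := by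
  intro v X
  have hn0 : (n : ℝ) ≠ 0 := by positivity
  have hm0 : (m : ℝ) ≠ 0 := by positivity
  have hnm0 : (n : ℝ) + m ≠ 0 := by positivity
  have hX : X = (1 / ((n : ℝ) * m * (n + m))) • Matrix.vecMulVec v v := rfl
  have hsum : (∑ i, v i) = 0 := by
    simp [v, Fintype.sum_sum_type]; ring
  refine ⟨?_, ?_, ?_, ?_⟩
  · rw [hX]
    have h := Matrix.posSemidef_vecMulVec_self_star v
    rw [star_trivial] at h
    exact h.smul (by positivity)
  · simp [X, v, Matrix.trace, Fintype.sum_sum_type]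
    field_simp
    ring
  · ext i
    simp only [X, Matrix.mulVec, dotProduct, Matrix.smul_apply, Matrix.of_apply, smul_eq_mul,
      mul_one, Pi.zero_apply]
    rw [← Finset.mul_sum, ← Finset.mul_sum, hsum]
    simp
  · have hv : supraLap L₁ L₂ W *ᵥ v = lam2 (supraLap L₁ L₂ W) • v := by
      rw [hopt]
      have e1 : (fun _ => (m : ℝ) : Fin n → ℝ) = (m : ℝ) • (fun _ => (1 : ℝ)) := by
        ext; simp
      have e2 : (fun _ => -(n : ℝ) : Fin m → ℝ) = (-(n : ℝ)) • (fun _ => (1 : ℝ)) := by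
        ext; simp
      unfold supraLap
      simp only [v]
      rw [Matrix.fromBlocks_mulVec, Sum.elim_comp_inl, Sum.elim_comp_inr, e1, e2]
      simp only [Matrix.mulVec_smul, Matrix.add_mulVec, Matrix.neg_mulVec, hL₁1, hL₂1, hreg1,
        hreg2]
      ext i
      rcases i with i | i
      · simp [Matrix.mulVec_diagonal]
        field_simp
        try ring
      · simp [Matrix.mulVec_diagonal]
        field_simp
        try ring
    rw [hX, Matrix.mul_smul, Matrix.mul_vecMulVec, hv, Matrix.smul_vecMulVec, smul_comm]
end

section
/- For the uniform all-pairs weight matrix W_c = (c/(nm))J with c ≥ 0: if u ∈ ℝⁿ satisfies uᵀ1ₙ = 0 and L₁u = λ·u, then the vector [u; 0] ∈ ℝᴺ is an eigenvector of the supra-Laplacian with L(W_c)·[u; 0] = (λ + c/n)·[u; 0]. -/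
open Matrix

theorem stmt_9 {n m : ℕ} (hn : 2 ≤ n) (hm : 2 ≤ m)
    (L₁ : Matrix (Fin n) (Fin n) ℝ) (L₂ : Matrix (Fin m) (Fin m) ℝ)
    (hL₁ : L₁.PosSemidef) (hL₂ : L₂.PosSemidef)
    (hL₁1 : L₁ *ᵥ (fun _ => 1) = 0) (hL₂1 : L₂ *ᵥ (fun _ => 1) = 0)
    (c : ℝ) (hc : 0 ≤ c)
    (u : Fin n → ℝ) (husum : (∑ i, u i) = 0) (lam : ℝ) (hueig : L₁ *ᵥ u = lam • u) :
    supraLap L₁ L₂ (Matrix.of fun _ _ => c / ((n : ℝ) * m)) *ᵥ Sum.elim u (fun _ => 0) =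
      (lam + c / n) • Sum.elim u (fun _ => 0) := by
  have hm0 : (m : ℝ) ≠ 0 := by
    have : m ≠ 0 := by omega
    exact_mod_cast this
  have hn0 : (n : ℝ) ≠ 0 := by
    have : n ≠ 0 := by omega
    exact_mod_cast this
  have hz : (fun _ : Fin m => (0 : ℝ)) = 0 := rfl
  unfold supraLap
  rw [Matrix.fromBlocks_mulVec, Sum.elim_comp_inl, Sum.elim_comp_inr, hz,
    Matrix.mulVec_zero, Matrix.mulVec_zero, Matrix.add_mulVec, hueig]
  ext x
  rcases x with i | j
  · simp only [Sum.elim_inl, Pi.add_apply, Pi.smul_apply, Pi.zero_apply, smul_eq_mul,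
      Matrix.mulVec_diagonal]
    have h : ((Matrix.of fun (_ : Fin n) (_ : Fin m) => c / ((n : ℝ) * m)) *ᵥ
        fun _ => (1 : ℝ)) i = c / n := by
      simp [Matrix.mulVec, dotProduct]
      field_simp
    rw [h]
    ring
  · simp [Matrix.mulVec, dotProduct, ← Finset.mul_sum, husum]
end

section
/- For the uniform all-pairs weight matrix W_c = (c/(nm))J with c ≥ 0: if v ∈ ℝᵐ satisfies vᵀ1ₘ = 0 and L₂v = λ·v, then the vector [0; v] ∈ ℝᴺ is an eigenvector of the supra-Laplacian with L(W_c)·[0; v] = (λ + c/m)·[0; v]. -/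
open Matrix

theorem stmt_10 {n m : ℕ} (hn : 2 ≤ n) (hm : 2 ≤ m)
    (L₁ : Matrix (Fin n) (Fin n) ℝ) (L₂ : Matrix (Fin m) (Fin m) ℝ)
    (hL₁ : L₁.PosSemidef) (hL₂ : L₂.PosSemidef)
    (hL₁1 : L₁ *ᵥ (fun _ => 1) = 0) (hL₂1 : L₂ *ᵥ (fun _ => 1) = 0)
    (c : ℝ) (hc : 0 ≤ c)
    (v : Fin m → ℝ) (hvsum : (∑ j, v j) = 0) (lam : ℝ) (hveig : L₂ *ᵥ v = lam • v) :
    supraLap L₁ L₂ (Matrix.of fun _ _ => c / ((n : ℝ) * m)) *ᵥ Sum.elim (fun _ => 0) v =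
      (lam + c / m) • Sum.elim (fun _ => 0) v := by
  have hn0 : (n : ℝ) ≠ 0 := by
    have : n ≠ 0 := by omega
    exact_mod_cast this
  have hm0 : (m : ℝ) ≠ 0 := by
    have : m ≠ 0 := by omega
    exact_mod_cast this
  have hz : (fun _ => 0 : Fin n → ℝ) = 0 := rfl
  unfold supraLap
  rw [Matrix.fromBlocks_mulVec]
  ext i
  rcases i with i | j
  · simp [hz, Matrix.neg_mulVec, Matrix.mulVec, dotProduct, ← Finset.mul_sum, hvsum]
  · have h := congrFun hveig j
    simp only [Sum.elim_comp_inl, Sum.elim_comp_inr, hz, Matrix.mulVec_zero, zero_add,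
      Matrix.add_mulVec, Sum.elim_inr, Pi.add_apply, Pi.smul_apply, smul_eq_mul, h,
      Matrix.mulVec_diagonal]
    simp [Matrix.mulVec, dotProduct]
    field_simp
end

section
/- Let c ≥ 0 and W_c = (c/(nm))J. Let {u₁ = 1ₙ/√n, u₂, …, uₙ} be an orthonormal basis of ℝⁿ of eigenvectors of L₁ with L₁uᵢ = λᵢ⁽¹⁾uᵢ, and {v₁ = 1ₘ/√m, v₂, …, vₘ} an orthonormal basis of ℝᵐ of eigenvectors of L₂ with L₂vⱼ = λⱼ⁽²⁾vⱼ. Then the N = n+m vectors consisting of 1_N/√N, the vectors [uᵢ; 0] for i = 2,…,n, the vectors [0; vⱼ] for j = 2,…,m, and the vector (nm(n+m))^{−1/2}·[m·1ₙ; −n·1ₘ], form an orthonormal basis of ℝᴺ of eigenvectors of L(W_c), with respective eigenvalues 0, λᵢ⁽¹⁾ + c/n, λⱼ⁽²⁾ + c/m, and (1/n + 1/m)·c. -/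
open Matrix

theorem supraLap_const_mulVec {n m : ℕ} (L₁ : Matrix (Fin n) (Fin n) ℝ)
    (L₂ : Matrix (Fin m) (Fin m) ℝ) (k : ℝ) (x : Fin n → ℝ) (y : Fin m → ℝ) :
    supraLap L₁ L₂ (Matrix.of fun _ _ => k) *ᵥ Sum.elim x y =
      Sum.elim (fun i => (L₁ *ᵥ x) i + m * k * x i - k * ∑ j, y j)
        (fun j => (L₂ *ᵥ y) j + n * k * y j - k * ∑ i, x i) := by
  unfold supraLap
  rw [Matrix.fromBlocks_mulVec]
  ext a
  rcases a with i | j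
  · simp [Matrix.add_mulVec, Matrix.neg_mulVec, Matrix.mulVec_diagonal]
    simp [Matrix.mulVec, dotProduct, Finset.mul_sum]
    ring
  · simp [Matrix.add_mulVec, Matrix.neg_mulVec, Matrix.mulVec_diagonal]
    simp [Matrix.mulVec, dotProduct, Finset.mul_sum]
    ring

theorem sum_zero_of_ortho {n : ℕ} (hn : 0 < n) (u : Fin n → Fin n → ℝ)
    (hu0 : u ⟨0, hn⟩ = fun _ => 1 / Real.sqrt n)
    (huortho : ∀ i j, u i ⬝ᵥ u j = if i = j then 1 else 0)
    (i : Fin n) (hi : i ≠ ⟨0, hn⟩) : ∑ k, u i k = 0 := by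
  have h := huortho i ⟨0, hn⟩
  rw [if_neg hi, hu0] at h
  simp only [dotProduct] at h
  rw [← Finset.sum_mul] at h
  have : (1 / Real.sqrt n) ≠ 0 := by positivity
  exact (mul_eq_zero.mp h).resolve_right this

theorem mulVec_const_zero {n : ℕ} (L : Matrix (Fin n) (Fin n) ℝ)
    (h : L *ᵥ (fun _ => 1) = 0) (t : ℝ) : L *ᵥ (fun _ => t) = 0 := by
  have : (fun _ : Fin n => t) = t • (fun _ => (1 : ℝ)) := by ext; simp
  rw [this, Matrix.mulVec_smul, h, smul_zero]

theorem stmt_11 {n m : ℕ} (hn : 2 ≤ n) (hm : 2 ≤ m)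
    (L₁ : Matrix (Fin n) (Fin n) ℝ) (L₂ : Matrix (Fin m) (Fin m) ℝ)
    (hL₁ : L₁.PosSemidef) (hL₂ : L₂.PosSemidef)
    (hL₁1 : L₁ *ᵥ (fun _ => 1) = 0) (hL₂1 : L₂ *ᵥ (fun _ => 1) = 0)
    (c : ℝ) (hc : 0 ≤ c)
    (u : Fin n → Fin n → ℝ) (lam1 : Fin n → ℝ)
    (hu0 : u ⟨0, by omega⟩ = fun _ => 1 / Real.sqrt n)
    (huortho : ∀ i j, u i ⬝ᵥ u j = if i = j then 1 else 0)
    (hueig : ∀ i, L₁ *ᵥ u i = lam1 i • u i)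
    (v : Fin m → Fin m → ℝ) (lam2' : Fin m → ℝ)
    (hv0 : v ⟨0, by omega⟩ = fun _ => 1 / Real.sqrt m)
    (hvortho : ∀ i j, v i ⬝ᵥ v j = if i = j then 1 else 0)
    (hveig : ∀ j, L₂ *ᵥ v j = lam2' j • v j) :
    let B : Fin n ⊕ Fin m → (Fin n ⊕ Fin m → ℝ) := fun a =>
      match a with
      | Sum.inl i =>
          if i = (⟨0, by omega⟩ : Fin n) then (fun _ => 1 / Real.sqrt (n + m))
          else Sum.elim (u i) (fun _ => 0)
      | Sum.inr j =>
          if j = (⟨0, by omega⟩ : Fin m) then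
            Sum.elim (fun _ => (m : ℝ) / Real.sqrt ((n : ℝ) * m * (n + m)))
              (fun _ => -(n : ℝ) / Real.sqrt ((n : ℝ) * m * (n + m)))
          else Sum.elim (fun _ => 0) (v j)
    let eig : Fin n ⊕ Fin m → ℝ := fun a =>
      match a with
      | Sum.inl i => if i = (⟨0, by omega⟩ : Fin n) then 0 else lam1 i + c / n
      | Sum.inr j =>
          if j = (⟨0, by omega⟩ : Fin m) then (1 / (n : ℝ) + 1 / (m : ℝ)) * c
          else lam2' j + c / m
    (∀ a b, B a ⬝ᵥ B b = if a = b then 1 else 0) ∧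
    (∀ a, supraLap L₁ L₂ (Matrix.of fun _ _ => c / ((n : ℝ) * m)) *ᵥ B a = eig a • B a) := by
  have hn0 : (0 : ℝ) < n := by exact_mod_cast (by omega : 0 < n)
  have hm0 : (0 : ℝ) < m := by exact_mod_cast (by omega : 0 < m)
  have hsu := sum_zero_of_ortho (by omega) u hu0 huortho
  have hsv := sum_zero_of_ortho (by omega) v hv0 hvortho
  have hz1 := mulVec_const_zero L₁ hL₁1
  have hz2 := mulVec_const_zero L₂ hL₂1
  have hzz1 : L₁ *ᵥ (fun _ => (0 : ℝ)) = 0 := hz1 0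
  have hzz2 : L₂ *ᵥ (fun _ => (0 : ℝ)) = 0 := hz2 0
  have hs1 : Real.sqrt (n + m) * Real.sqrt (n + m) = (n + m : ℝ) :=
    Real.mul_self_sqrt (by positivity)
  have hs2 : Real.sqrt ((n : ℝ) * m * (n + m)) * Real.sqrt ((n : ℝ) * m * (n + m))
      = (n : ℝ) * m * (n + m) := Real.mul_self_sqrt (by positivity)
  have hp1 : 0 < Real.sqrt (n + m : ℝ) := Real.sqrt_pos.mpr (by positivity)
  have hp2 : 0 < Real.sqrt ((n : ℝ) * m * (n + m)) := Real.sqrt_pos.mpr (by positivity)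
  have hconst : (fun _ : Fin n ⊕ Fin m => 1 / Real.sqrt (n + m : ℝ)) =
      Sum.elim (fun _ => 1 / Real.sqrt (n + m : ℝ)) (fun _ => 1 / Real.sqrt (n + m : ℝ)) := by
    ext a; rcases a with a | a <;> rfl
  have hdot : ∀ (x x' : Fin n → ℝ) (y y' : Fin m → ℝ),
      Sum.elim x y ⬝ᵥ Sum.elim x' y' = x ⬝ᵥ x' + y ⬝ᵥ y' := by
    intro x x' y y'; simp [dotProduct]
  have hcl : ∀ (t : ℝ) (x : Fin n → ℝ), (fun _ => t) ⬝ᵥ x = t * ∑ i, x i := by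
    intro t x; simp [dotProduct, Finset.mul_sum]
  have hcr : ∀ (t : ℝ) (x : Fin n → ℝ), x ⬝ᵥ (fun _ => t) = t * ∑ i, x i := by
    intro t x; rw [dotProduct_comm, hcl]
  have hcl' : ∀ (t : ℝ) (x : Fin m → ℝ), (fun _ => t) ⬝ᵥ x = t * ∑ i, x i := by
    intro t x; simp [dotProduct, Finset.mul_sum]
  have hcr' : ∀ (t : ℝ) (x : Fin m → ℝ), x ⬝ᵥ (fun _ => t) = t * ∑ i, x i := by
    intro t x; rw [dotProduct_comm, hcl']
  have hnm : (n + m : ℝ) ≠ 0 := by positivity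
  generalize Real.sqrt (n + m : ℝ) = s at *
  generalize Real.sqrt ((n : ℝ) * m * (n + m)) = r at *
  have hconst' : (fun _ : Fin n ⊕ Fin m => s⁻¹) = Sum.elim (fun _ => s⁻¹) (fun _ => s⁻¹) := by
    ext a; rcases a with a | a <;> rfl
  intro B eig
  refine ⟨?_, ?_⟩
  · rintro (i | j) (i' | j')
    · by_cases h : i = ⟨0, by omega⟩ <;> by_cases h' : i' = ⟨0, by omega⟩
      · simp only [B, h, h', if_true, hconst, hdot, hcl, hcl']
        simp
        field_simp
        nlinarith
      · have : ¬ (⟨0, by omega⟩ : Fin n) = i' := fun e => h' e.symm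
        simp [B, h, h', this, hconst', -Sum.elim_lam_const_lam_const, hdot, hcl, hcl', hsu]
      · simp [B, h, h', hconst', -Sum.elim_lam_const_lam_const, hdot, hcr, hcr', hsu]
      · simp [B, h, h', hdot, hcr', huortho]
    · by_cases h : i = ⟨0, by omega⟩ <;> by_cases h' : j' = ⟨0, by omega⟩
      · simp only [B, h, h', if_true, hconst, hdot, hcl, hcl']
        simp
        field_simp
        ring
      · simp [B, h, h', hconst', -Sum.elim_lam_const_lam_const, hdot, hcl, hcl', hsv]
      · simp [B, h, h', hdot, hcr, hcr', hsu]
      · simp [B, h, h', hdot, hcr, hcl', hcl]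
    · by_cases h : j = ⟨0, by omega⟩ <;> by_cases h' : i' = ⟨0, by omega⟩
      · simp only [B, h, h', if_true, hconst, hdot, hcl, hcl']
        simp
        field_simp
        ring
      · simp [B, h, h', hdot, hcl, hcr', hsu]
      · simp [B, h, h', hconst', -Sum.elim_lam_const_lam_const, hdot, hcr, hcr', hsv]
      · simp [B, h, h', hdot, hcl, hcr']
    · by_cases h : j = ⟨0, by omega⟩ <;> by_cases h' : j' = ⟨0, by omega⟩
      · simp only [B, h, h', if_true, hdot, hcl, hcl']
        simp
        field_simp
        nlinarith
      · have : ¬ (⟨0, by omega⟩ : Fin m) = j' := fun e => h' e.symm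
        simp [B, h, h', this, hdot, hcr, hcl', hsv]
      · simp [B, h, h', hdot, hcl, hcr', hsv]
      · simp [B, h, h', hdot, hcr, hvortho]
  · rintro (i | j)
    · by_cases h : i = ⟨0, by omega⟩
      · simp only [B, eig, h, if_true, hconst, supraLap_const_mulVec, hz1, hz2]
        ext (a | a) <;> simp <;> field_simp <;> ring
      · simp only [B, eig, h, if_false, supraLap_const_mulVec, hzz2, hueig, hsu i h]
        ext (a | a) <;> simp <;> field_simp
    · by_cases h : j = ⟨0, by omega⟩
      · simp only [B, eig, h, if_true, supraLap_const_mulVec, hz1, hz2]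
        ext (a | a) <;> simp <;> field_simp <;> ring
      · simp only [B, eig, h, if_false, supraLap_const_mulVec, hzz1, hveig, hsv j h]
        ext (a | a) <;> simp <;> field_simp
end

section
/- For every c ≥ 0, the algebraic connectivity of the supra-Laplacian with uniform all-pairs interlayer weights is λ₂(L(W_c)) = min{ (1/n + 1/m)·c, λ₂(L₁) + c/n, λ₂(L₂) + c/m }. -/
open Matrix

lemma quad_form {n m : ℕ} (L₁ : Matrix (Fin n) (Fin n) ℝ) (L₂ : Matrix (Fin m) (Fin m) ℝ)
    (w : ℝ) (x : Fin n → ℝ) (y : Fin m → ℝ) :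
    (Sum.elim x y) ⬝ᵥ (supraLap L₁ L₂ (Matrix.of fun _ _ => w) *ᵥ (Sum.elim x y)) =
      x ⬝ᵥ (L₁ *ᵥ x) + y ⬝ᵥ (L₂ *ᵥ y) + (m * w) * ∑ i, x i ^ 2 + (n * w) * ∑ j, y j ^ 2
        - 2 * w * (∑ i, x i) * (∑ j, y j) := by
  have h1 : (Matrix.of fun (_ : Fin n) (_ : Fin m) => w) *ᵥ (fun _ => (1:ℝ)) = fun _ => m * w := by
    ext i; simp [Matrix.mulVec, dotProduct]
  have h2 : (Matrix.of fun (_ : Fin n) (_ : Fin m) => w)ᵀ *ᵥ (fun _ => (1:ℝ)) = fun _ => n * w := by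
    ext i; simp [Matrix.mulVec, dotProduct]
  have h3 : (Matrix.of fun (_ : Fin n) (_ : Fin m) => w) *ᵥ y = fun _ => w * ∑ j, y j := by
    ext i; simp [Matrix.mulVec, dotProduct, Finset.mul_sum]
  have h4 : (Matrix.of fun (_ : Fin n) (_ : Fin m) => w)ᵀ *ᵥ x = fun _ => w * ∑ j, x j := by
    ext i; simp [Matrix.mulVec, dotProduct, Finset.mul_sum]
  have h5 : x ⬝ᵥ (Matrix.diagonal (fun _ : Fin n => (m:ℝ) * w) *ᵥ x) = (m * w) * ∑ i, x i ^ 2 := by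
    simp only [dotProduct, Matrix.mulVec_diagonal, Finset.mul_sum]
    exact Finset.sum_congr rfl fun i _ => by ring
  have h6 : y ⬝ᵥ (Matrix.diagonal (fun _ : Fin m => (n:ℝ) * w) *ᵥ y) = (n * w) * ∑ i, y i ^ 2 := by
    simp only [dotProduct, Matrix.mulVec_diagonal, Finset.mul_sum]
    exact Finset.sum_congr rfl fun i _ => by ring
  have h7 : x ⬝ᵥ (fun _ => w * ∑ j, y j) = w * (∑ i, x i) * (∑ j, y j) := by
    simp only [dotProduct, ← Finset.sum_mul]; ring
  have h8 : y ⬝ᵥ (fun _ => w * ∑ j, x j) = w * (∑ i, x i) * (∑ j, y j) := by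
    simp only [dotProduct, ← Finset.sum_mul]; ring
  unfold supraLap
  rw [Matrix.fromBlocks_mulVec, h1, h2]
  simp only [Sum.elim_comp_inl, Sum.elim_comp_inr, sumElim_dotProduct_sumElim,
    Matrix.add_mulVec, Matrix.neg_mulVec, h3, h4, dotProduct_add, dotProduct_neg, h5, h6, h7, h8]
  ring

lemma sum_sq_pos' {K : Type*} [Fintype K] {v : K → ℝ} (hv : v ≠ 0) : 0 < ∑ i, v i ^ 2 := by
  obtain ⟨i, hi⟩ := Function.ne_iff.mp hv
  exact Finset.sum_pos' (fun i _ => sq_nonneg _) ⟨i, Finset.mem_univ _, by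
    have : v i ≠ 0 := hi
    positivity⟩

lemma lam2_mul_le {K : Type*} [Fintype K] (M : Matrix K K ℝ) (b : ℝ)
    (hb : ∀ v : K → ℝ, (∑ i, v i) = 0 → b * ∑ i, v i ^ 2 ≤ v ⬝ᵥ (M *ᵥ v))
    (v : K → ℝ) (hs : ∑ i, v i = 0) : lam2 M * ∑ i, v i ^ 2 ≤ v ⬝ᵥ (M *ᵥ v) := by
  by_cases hv : v = 0
  · subst hv; simp
  · rw [← le_div_iff₀ (sum_sq_pos' hv)]
    apply csInf_le
    · refine ⟨b, ?_⟩
      rintro r ⟨u, hu, hus, rfl⟩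
      rw [le_div_iff₀ (sum_sq_pos' hu)]
      exact hb u hus
    · exact ⟨v, hv, hs, rfl⟩

lemma le_lam2 {K : Type*} [Fintype K] (M : Matrix K K ℝ) (b : ℝ)
    (hne : ∃ v : K → ℝ, v ≠ 0 ∧ ∑ i, v i = 0)
    (hb : ∀ v : K → ℝ, (∑ i, v i) = 0 → b * ∑ i, v i ^ 2 ≤ v ⬝ᵥ (M *ᵥ v)) : b ≤ lam2 M := by
  apply le_csInf
  · obtain ⟨v, hv, hs⟩ := hne
    exact ⟨_, v, hv, hs, rfl⟩
  · rintro r ⟨u, hu, hus, rfl⟩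
    rw [le_div_iff₀ (sum_sq_pos' hu)]
    exact hb u hus

lemma exists_vec {n : ℕ} (hn : 2 ≤ n) : ∃ v : Fin n → ℝ, v ≠ 0 ∧ ∑ i, v i = 0 := by
  let i : Fin n := ⟨0, by omega⟩
  let j : Fin n := ⟨1, by omega⟩
  refine ⟨Pi.single i 1 - Pi.single j 1, ?_, ?_⟩
  · intro h
    have := congrFun h i
    simp [i, j, Pi.single_apply] at this
  · simp

lemma layer_bound {n : ℕ} (hn : 2 ≤ n) (L : Matrix (Fin n) (Fin n) ℝ) (hL : L.PosSemidef)
    (hL1 : L *ᵥ (fun _ => 1) = 0) (x : Fin n → ℝ) :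
    0 ≤ ∑ i, x i ^ 2 - (∑ i, x i) ^ 2 / n ∧
    lam2 L * (∑ i, x i ^ 2 - (∑ i, x i) ^ 2 / n) ≤ x ⬝ᵥ (L *ᵥ x) := by
  have hn0 : (n : ℝ) ≠ 0 := by positivity
  set a : ℝ := (∑ i, x i) / n with ha
  set x' : Fin n → ℝ := x - a • (fun _ => 1) with hx'
  have hs : ∑ i, x' i = 0 := by
    simp [hx', Finset.sum_sub_distrib, ha]; field_simp; simp
  have hq : ∑ i, x' i ^ 2 = ∑ i, x i ^ 2 - (∑ i, x i) ^ 2 / n := by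
    have : ∀ i, x' i ^ 2 = x i ^ 2 - 2 * a * x i + a ^ 2 := fun i => by
      simp [hx']; ring
    simp only [this, Finset.sum_add_distrib, Finset.sum_sub_distrib, ← Finset.mul_sum]
    simp [ha]; field_simp; ring
  have hL1' : (fun _ => (1:ℝ)) ᵥ* L = 0 := by
    rw [← Matrix.mulVec_transpose]
    have : Lᵀ = L := by simpa using hL.1.eq
    rw [this, hL1]
  have hQ : x' ⬝ᵥ (L *ᵥ x') = x ⬝ᵥ (L *ᵥ x) := by
    rw [hx', Matrix.mulVec_sub, Matrix.mulVec_smul, hL1, smul_zero, sub_zero, sub_dotProduct,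
      smul_dotProduct, Matrix.dotProduct_mulVec (fun _ => (1:ℝ)), hL1']
    simp
  rw [← hq, ← hQ]
  refine ⟨Finset.sum_nonneg fun i _ => sq_nonneg _, lam2_mul_le L 0 (fun v _ => ?_) x' hs⟩
  have := hL.dotProduct_mulVec_nonneg v
  simpa using this

theorem stmt_12 {n m : ℕ} (hn : 2 ≤ n) (hm : 2 ≤ m)
    (L₁ : Matrix (Fin n) (Fin n) ℝ) (L₂ : Matrix (Fin m) (Fin m) ℝ)
    (hL₁ : L₁.PosSemidef) (hL₂ : L₂.PosSemidef)
    (hL₁1 : L₁ *ᵥ (fun _ => 1) = 0) (hL₂1 : L₂ *ᵥ (fun _ => 1) = 0)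
    (c : ℝ) (hc : 0 ≤ c) :
    lam2 (supraLap L₁ L₂ (Matrix.of fun _ _ => c / ((n : ℝ) * m))) =
      min (min ((1 / (n : ℝ) + 1 / (m : ℝ)) * c) (lam2 L₁ + c / n)) (lam2 L₂ + c / m) := by
  have hn0 : (0 : ℝ) < n := by positivity
  have hm0 : (0 : ℝ) < m := by positivity
  set R := min (min ((1 / (n : ℝ) + 1 / (m : ℝ)) * c) (lam2 L₁ + c / n)) (lam2 L₂ + c / m) with hR
  have hR1 : R ≤ (1 / (n : ℝ) + 1 / (m : ℝ)) * c := (min_le_left _ _).trans (min_le_left _ _)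
  have hR2 : R ≤ lam2 L₁ + c / n := (min_le_left _ _).trans (min_le_right _ _)
  have hR3 : R ≤ lam2 L₂ + c / m := min_le_right _ _
  have e1 : (m : ℝ) * (c / (n * m)) = c / n := by field_simp
  have e2 : (n : ℝ) * (c / (n * m)) = c / m := by field_simp
  set M := supraLap L₁ L₂ (Matrix.of fun _ _ => c / ((n : ℝ) * m)) with hM
  have key : ∀ x y, (Sum.elim x y) ⬝ᵥ (M *ᵥ (Sum.elim x y)) =
      x ⬝ᵥ (L₁ *ᵥ x) + y ⬝ᵥ (L₂ *ᵥ y) + (c / n) * ∑ i, x i ^ 2 + (c / m) * ∑ j, y j ^ 2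
        - 2 * (c / (n * m)) * (∑ i, x i) * (∑ j, y j) := fun x y => by
    rw [hM, quad_form, e1, e2]
  have lower : ∀ v : Fin n ⊕ Fin m → ℝ, (∑ i, v i) = 0 → R * ∑ i, v i ^ 2 ≤ v ⬝ᵥ (M *ᵥ v) := by
    intro v hv
    obtain ⟨x, y, rfl⟩ : ∃ x y, v = Sum.elim x y :=
      ⟨v ∘ Sum.inl, v ∘ Sum.inr, (Sum.elim_comp_inl_inr v).symm⟩
    rw [key]
    simp only [Fintype.sum_sum_type, Sum.elim_inl, Sum.elim_inr] at hv ⊢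
    obtain ⟨p1, q1⟩ := layer_bound hn L₁ hL₁ hL₁1 x
    obtain ⟨p2, q2⟩ := layer_bound hm L₂ hL₂ hL₂1 y
    have hy : ∑ j, y j = - ∑ i, x i := by linarith
    rw [hy] at p2 q2 ⊢
    generalize ∑ i, x i = S at *
    have t1 := mul_le_mul_of_nonneg_right hR2 p1
    have t2 := mul_le_mul_of_nonneg_right hR3 p2
    have t3 := mul_le_mul_of_nonneg_right hR1
      (show (0:ℝ) ≤ S ^ 2 * (1 / n + 1 / m) by positivity)
    have i1 : c / ((n:ℝ) * m) = c * (1 / n) * (1 / m) := by field_simp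
    rw [i1]
    simp only [div_eq_mul_inv, one_mul] at *
    nlinarith
  have nonneg2 : ∀ v, (∑ i, v i) = 0 → lam2 M * ∑ i, v i ^ 2 ≤ v ⬝ᵥ (M *ᵥ v) :=
    lam2_mul_le M R lower
  apply le_antisymm
  · refine le_min (le_min ?_ ?_) ?_
    · have h := nonneg2 (Sum.elim (fun _ => (m:ℝ)) (fun _ => -(n:ℝ))) (by simp; ring)
      rw [key] at h
      have a1 : L₁ *ᵥ (fun _ => (m:ℝ)) = 0 := by
        have : (fun _ : Fin n => (m:ℝ)) = (m:ℝ) • (fun _ => 1) := by ext; simp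
        rw [this, Matrix.mulVec_smul, hL₁1, smul_zero]
      have a2 : L₂ *ᵥ (fun _ => -(n:ℝ)) = 0 := by
        have : (fun _ : Fin m => -(n:ℝ)) = (-(n:ℝ)) • (fun _ => 1) := by ext; simp
        rw [this, Matrix.mulVec_smul, hL₂1, smul_zero]
      rw [a1, a2] at h
      simp at h
      have hp : (0:ℝ) < n * m ^ 2 + m * n ^ 2 := by positivity
      refine le_of_mul_le_mul_right (h.trans (le_of_eq ?_)) hp
      field_simp
      ring
    · rw [← sub_le_iff_le_add]
      refine le_lam2 _ _ (exists_vec hn) fun x hx => ?_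
      have h := nonneg2 (Sum.elim x 0) (by simp [hx])
      rw [key] at h
      simp [hx] at h
      linarith
    · rw [← sub_le_iff_le_add]
      refine le_lam2 _ _ (exists_vec hm) fun x hx => ?_
      have h := nonneg2 (Sum.elim 0 x) (by simp [hx])
      rw [key] at h
      simp [hx] at h
      linarith
  · refine le_lam2 M R ?_ lower
    obtain ⟨x, hx, hs⟩ := exists_vec hn
    refine ⟨Sum.elim x 0, fun h => hx ?_, by simp [hs]⟩
    ext i
    simpa using congrFun h (Sum.inl i)
end
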